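/- For a state-finite automaton A = (A, X, δ) without outputs the following are equivalent: (i) A is a Boolean-type retractable automaton; (ii) A is a direct sum of finitely many state-finite Boolean-type retractable automata, each containing a kernel, whose kernels are pairwise isomorphic. -/

import Mathlib

/-! Basic notions for state-finite automata without outputs, following M. Fuzesdi,
"Boolean-type retractable state-finite automata without outputs". -/

variable {A X : Type*}

/-- The transition function extended to words: `DeltaStar d a p = δ(a, p)`. -/
def DeltaStar (d : A → X → A) (a : A) (p : List X) : A := p.foldl d a

/-- `B` is (the state set of) a subautomaton of the automaton `(A, X, d)`. -/
def IsSubaut (d : A → X → A) (B : Set A) : Prop :=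
  B.Nonempty ∧ ∀ b ∈ B, ∀ x, d b x ∈ B

/-- `f` (restricted to `B`) is a retract homomorphism of the automaton `B`
onto its subautomaton `C`: it commutes with the transitions on `B`, maps `B` into `C`,
and leaves the elements of `C` fixed (hence is onto `C` whenever `C ⊆ B`). -/
def IsRetractHomOn (d : A → X → A) (B C : Set A) (f : A → A) : Prop :=
  (∀ a ∈ B, ∀ x, f (d a x) = d (f a) x) ∧ (∀ a ∈ B, f a ∈ C) ∧ (∀ c ∈ C, f c = c)

/-- The automaton `B` is retractable: every subautomaton of `B` is a retract
subautomaton of `B`. -/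
def RetractableOn (d : A → X → A) (B : Set A) : Prop :=
  ∀ C, C ⊆ B → IsSubaut d C → ∃ f : A → A, IsRetractHomOn d B C f

/-- The automaton `B` is a Boolean-type retractable automaton: it is retractable and there
is a family of retract homomorphisms `Λ C` of `B` onto `C`, one for each subautomaton `C`
of `B`, such that `C₁ ⊆ C₂` implies `Ker (Λ C₂) ⊆ Ker (Λ C₁)` (kernels taken on `B`). -/
def BooleanTypeOn (d : A → X → A) (B : Set A) : Prop :=
  RetractableOn d B ∧
  ∃ Λ : Set A → (A → A),
    (∀ C, C ⊆ B → IsSubaut d C → IsRetractHomOn d B C (Λ C)) ∧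
    (∀ C₁ C₂, C₁ ⊆ C₂ → C₂ ⊆ B → IsSubaut d C₁ → IsSubaut d C₂ →
      ∀ a ∈ B, ∀ b ∈ B, Λ C₂ a = Λ C₂ b → Λ C₁ a = Λ C₁ b)

/-- The Rees congruence defined by `B`. -/
def ReesRel (B : Set A) : A → A → Prop := fun a b => a = b ∨ (a ∈ B ∧ b ∈ B)

/-- The kernel of a map, as a relation. -/
def KerRel (f : A → A) : A → A → Prop := fun a b => f a = f b

/-- `r` is a congruence of the automaton `(A, X, d)`. -/
def IsCong (d : A → X → A) (r : A → A → Prop) : Prop :=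
  Equivalence r ∧ ∀ a b, r a b → ∀ x, r (d a x) (d b x)

/-- `K` is the kernel of the automaton `B`: a subautomaton of `B` contained in every
subautomaton of `B`. -/
def IsKernelOf (d : A → X → A) (B K : Set A) : Prop :=
  IsSubaut d K ∧ K ⊆ B ∧ ∀ C, C ⊆ B → IsSubaut d C → K ⊆ C

/-- The subautomata `S` and `T` (with the common transition function `d`) are isomorphic. -/
def AutIsoOn (d : A → X → A) (S T : Set A) : Prop :=
  ∃ f : A → A, Set.BijOn f S T ∧ ∀ a ∈ S, ∀ x, f (d a x) = d (f a) x

/-- `c` is a trap of the automaton with transition function `d`. -/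
def IsTrapT (d : A → X → A) (c : A) : Prop := ∀ x, d c x = c

/-- The automaton with transition function `d` is strongly connected. -/
def StronglyConnT (d : A → X → A) : Prop :=
  ∀ a b : A, ∃ p : List X, p ≠ [] ∧ DeltaStar d a p = b

/-- The automaton with transition function `d` is strongly trap connected. -/
def StronglyTrapConnT (d : A → X → A) : Prop :=
  ∃ a₀ : A, IsTrapT d a₀ ∧ (∀ c, IsTrapT d c → c = a₀) ∧
    ∀ a, a ≠ a₀ → ∀ b, ∃ p : List X, p ≠ [] ∧ DeltaStar d a p = b

/-- `R(a)`: the subautomaton generated by `a`. -/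
def Rset (d : A → X → A) (a : A) : Set A := {b | ∃ p : List X, DeltaStar d a p = b}

lemma Rset_closed (d : A → X → A) (a : A) {b : A} (hb : b ∈ Rset d a) (x : X) :
    d b x ∈ Rset d a := by
  obtain ⟨p, hp⟩ := hb
  refine ⟨p ++ [x], ?_⟩
  simp only [DeltaStar, List.foldl_append, List.foldl_cons, List.foldl_nil]
  rw [show List.foldl d a p = b from hp]

lemma Rset_mono (d : A → X → A) {a b : A} (h : b ∈ Rset d a) : Rset d b ⊆ Rset d a := by
  obtain ⟨q, hq⟩ := h
  rintro c ⟨p, hp⟩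
  refine ⟨q ++ p, ?_⟩
  simp only [DeltaStar, List.foldl_append] at *
  rw [hq, hp]

/-- `R_a`: the set of states generating the same subautomaton as `a`. -/
def Rcls (d : A → X → A) (a : A) : Set A := {b | Rset d b = Rset d a}

/-- `R[a] = R(a) \ R_a`. -/
def Rbr (d : A → X → A) (a : A) : Set A := Rset d a \ Rcls d a

lemma Rbr_closed (d : A → X → A) (a : A) {b : A} (hb : b ∈ Rbr d a) (x : X) :
    d b x ∈ Rbr d a := by
  refine ⟨Rset_closed d a hb.1 x, fun hmem => hb.2 ?_⟩
  have h1 : Rset d b ⊆ Rset d a := Rset_mono d hb.1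
  have hx : d b x ∈ Rset d b := ⟨[x], rfl⟩
  have h2 : Rset d a ⊆ Rset d b := by
    have := Rset_mono d hx
    rw [show Rset d (d b x) = Rset d a from hmem] at this
    exact this
  exact Set.Subset.antisymm h1 h2

/-- The Rees setoid on `R(a)` collapsing the subautomaton `R[a]` to a point. -/
def PFSetoid (d : A → X → A) (a : A) : Setoid ↥(Rset d a) where
  r s t := s = t ∨ (s.1 ∈ Rbr d a ∧ t.1 ∈ Rbr d a)
  iseqv := by
    refine ⟨fun s => Or.inl rfl, ?_, ?_⟩
    · rintro s t (rfl | ⟨h1, h2⟩)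
      · exact Or.inl rfl
      · exact Or.inr ⟨h2, h1⟩
    · rintro s t u (rfl | ⟨h1, h2⟩) (rfl | ⟨h3, h4⟩)
      · exact Or.inl rfl
      · exact Or.inr ⟨h3, h4⟩
      · exact Or.inr ⟨h1, h2⟩
      · exact Or.inr ⟨h1, h4⟩

/-- The state set of the principal factor `R{a} = R(a)/ρ_{R[a]}`. -/
def PFC (d : A → X → A) (a : A) : Type _ := Quotient (PFSetoid d a)

/-- The transition function of the principal factor `R{a}`. -/
def pfd (d : A → X → A) (a : A) : PFC d a → X → PFC d a := fun q x =>
  Quotient.liftOn q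
    (fun s => (Quotient.mk (PFSetoid d a) ⟨d s.1 x, Rset_closed d a s.2 x⟩ : PFC d a))
    (fun s t hst => Quotient.sound (by
      rcases hst with h | ⟨h1, h2⟩
      · exact Or.inl (by rw [h])
      · exact Or.inr ⟨Rbr_closed d a h1 x, Rbr_closed d a h2 x⟩))

/-- The automaton with transition function `d` is semi-connected: each of its
principal factors is strongly connected or strongly trap connected. -/
def SemiConnT (d : A → X → A) : Prop :=
  ∀ a : A, StronglyConnT (pfd d a) ∨ StronglyTrapConnT (pfd d a)

/-- The restriction of the transition function to a subautomaton. -/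
def restrictMap (d : A → X → A) (B : Set A) (h : ∀ b ∈ B, ∀ x, d b x ∈ B) : B → X → B :=
  fun b x => ⟨d b.1 x, h b.1 b.2 x⟩

open Classical in
/-- `A⁰`: the state set with the trap removed, in case the automaton is non-trivial
and has a unique trap; the whole state set otherwise. -/
noncomputable def ZeroPart (d : A → X → A) : Set A :=
  if Nontrivial A ∧ (∃! c : A, IsTrapT d c) then {c | ¬ IsTrapT d c} else Set.univ

lemma self_mem_Rset (d : A → X → A) (a : A) : a ∈ Rset d a := ⟨[], rfl⟩

lemma isSubaut_Rset (d : A → X → A) (a : A) : IsSubaut d (Rset d a) :=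
  ⟨⟨a, self_mem_Rset d a⟩, fun _ hb x => Rset_closed d a hb x⟩

lemma Rset_subset_of_mem {d : A → X → A} {B : Set A} (hB : ∀ b ∈ B, ∀ x, d b x ∈ B) {a : A}
    (ha : a ∈ B) : Rset d a ⊆ B := by
  rintro b ⟨p, rfl⟩
  induction p generalizing a with
  | nil => exact ha
  | cons x p ih => exact ih (hB a ha x)

lemma IsSubaut.inter {d : A → X → A} {B C : Set A} (hB : IsSubaut d B) (hC : IsSubaut d C)
    (h : (B ∩ C).Nonempty) : IsSubaut d (B ∩ C) :=
  ⟨h, fun b hb x => ⟨hB.2 b hb.1 x, hC.2 b hb.2 x⟩⟩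

lemma IsSubaut.union {d : A → X → A} {B C : Set A} (hB : IsSubaut d B) (hC : IsSubaut d C) :
    IsSubaut d (B ∪ C) :=
  ⟨hB.1.inl, fun b hb x => hb.imp (fun h => hB.2 b h x) (fun h => hC.2 b h x)⟩

lemma IsSubaut.image {d : A → X → A} {B : Set A} (hB : IsSubaut d B) {f : A → A}
    (hf : ∀ a ∈ B, ∀ x, f (d a x) = d (f a) x) : IsSubaut d (f '' B) := by
  refine ⟨hB.1.image f, ?_⟩
  rintro _ ⟨a, ha, rfl⟩ x
  exact ⟨d a x, hB.2 a ha x, hf a ha x⟩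

/-- A Boolean-type retractable automaton restricts to any of its subautomata. -/
lemma BooleanTypeOn.mono {d : A → X → A} {B C : Set A} (h : BooleanTypeOn d C) (hBC : B ⊆ C) :
    BooleanTypeOn d B := by
  obtain ⟨-, L, hL, hker⟩ := h
  have hL' : ∀ D, D ⊆ B → IsSubaut d D → IsRetractHomOn d B D (L D) := fun D hD hs =>
    have h := hL D (hD.trans hBC) hs
    ⟨fun a ha => h.1 a (hBC ha), fun a ha => h.2.1 a (hBC ha), h.2.2⟩
  exact ⟨fun D hD hs => ⟨L D, hL' D hD hs⟩, L, hL', fun D₁ D₂ h12 hD h1 h2 a ha b hb =>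
    hker D₁ D₂ h12 (hD.trans hBC) h1 h2 a (hBC ha) b (hBC hb)⟩

/-- In a retractable automaton the subautomaton generated by a state meets at most one
minimal subautomaton. -/
lemma RetractableOn.minimal_unique {d : A → X → A} (h : RetractableOn d Set.univ) {K L : Set A}
    (hK : Minimal (IsSubaut d) K) (hL : Minimal (IsSubaut d) L) {a : A}
    (haK : K ⊆ Rset d a) (haL : L ⊆ Rset d a) : K = L := by
  obtain ⟨f, hf, hmem, hfix⟩ := h (K ∪ L) (Set.subset_univ _) (hK.prop.union hL.prop)
  have key : ∀ M N : Set A, IsSubaut d M → Minimal (IsSubaut d) N → N ⊆ Rset d a →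
      N ⊆ K ∪ L → f a ∈ M → N ⊆ M := by
    intro M N hM hN haN hNKL hfa
    have hsub : Rset d a ⊆ f ⁻¹' M :=
      Rset_subset_of_mem (fun b hb x => by
        change f (d b x) ∈ M
        rw [hf b trivial x]
        exact hM.2 _ hb x) hfa
    intro c hc
    have := hsub (haN hc)
    rwa [Set.mem_preimage, hfix c (hNKL hc)] at this
  rcases hmem a trivial with ha | ha
  · exact (hK.eq_of_le hL.prop (key K L hK.prop hL haL Set.subset_union_right ha)).symm
  · exact hL.eq_of_le hK.prop (key L K hL.prop hK haK Set.subset_union_left ha)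

/-- The minimal subautomata of a finite retractable automaton are pairwise isomorphic. -/
lemma RetractableOn.autIsoOn_minimal [Finite A] {d : A → X → A} (h : RetractableOn d Set.univ)
    {K L : Set A} (hK : Minimal (IsSubaut d) K) (hL : Minimal (IsSubaut d) L) :
    AutIsoOn d K L := by
  have key : ∀ M N : Set A, IsSubaut d M → Minimal (IsSubaut d) N →
      ∃ f : A → A, (∀ a ∈ M, ∀ x, f (d a x) = d (f a) x) ∧ f '' M = N := by
    intro M N hM hN
    obtain ⟨f, hf, hmem, -⟩ := h N (Set.subset_univ _) hN.prop
    have hf' : ∀ a ∈ M, ∀ x, f (d a x) = d (f a) x := fun a _ => hf a trivial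
    refine ⟨f, hf', hN.eq_of_le (hM.image hf') ?_⟩
    rintro _ ⟨a, -, rfl⟩
    exact hmem a trivial
  obtain ⟨f, hf, hfKL⟩ := key K L hK.prop hL
  obtain ⟨g, -, hgLK⟩ := key L K hL.prop hK
  have hcard : (f '' K).ncard = K.ncard := by
    refine le_antisymm (Set.ncard_image_le K.toFinite) ?_
    rw [hfKL]
    conv_lhs => rw [← hgLK]
    exact Set.ncard_image_le L.toFinite
  exact ⟨f, ⟨fun a ha => hfKL ▸ Set.mem_image_of_mem f ha,
    Set.injOn_of_ncard_image_eq hcard, hfKL.ge⟩, hf⟩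

lemma AutIsoOn.exists_inverse [Nonempty A] {d : A → X → A} {S T : Set A}
    (hS : IsSubaut d S) (h : AutIsoOn d S T) :
    ∃ f g : A → A, Set.MapsTo f S T ∧ Set.MapsTo g T S ∧
      (∀ a ∈ S, g (f a) = a) ∧ (∀ b ∈ T, f (g b) = b) ∧
      (∀ a ∈ S, ∀ x, f (d a x) = d (f a) x) ∧ (∀ b ∈ T, ∀ x, g (d b x) = d (g b) x) := by
  obtain ⟨f, hbij, hf⟩ := h
  have hinv := hbij.invOn_invFunOn
  have hg := hbij.surjOn.mapsTo_invFunOn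
  refine ⟨f, Function.invFunOn f S, hbij.mapsTo, hg, hinv.1, hinv.2, hf, fun b hb x => ?_⟩
  have hgb := hg hb
  have := hinv.1 (hS.2 _ hgb x)
  rwa [hf _ hgb, hinv.2 hb] at this

/-- A finite Boolean-type retractable automaton is a direct sum of Boolean-type retractable
automata with pairwise isomorphic kernels. -/
lemma BooleanTypeOn.exists_direct_sum [Finite A] {δ : A → X → A}
    (h : BooleanTypeOn δ Set.univ) :
    ∃ (n : ℕ) (P K : Fin n → Set A),
      (∀ i, IsSubaut δ (P i)) ∧
      (∀ i j, i ≠ j → Disjoint (P i) (P j)) ∧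
      (⋃ i, P i) = Set.univ ∧
      (∀ i, BooleanTypeOn δ (P i)) ∧
      (∀ i, IsKernelOf δ (P i) (K i)) ∧
      (∀ i j, AutIsoOn δ (K i) (K j)) := by
  obtain ⟨n, ⟨e⟩⟩ := Finite.exists_equiv_fin {K : Set A // Minimal (IsSubaut δ) K}
  let K : Fin n → Set A := fun i => (e.symm i).1
  have hK : ∀ i, Minimal (IsSubaut δ) (K i) := fun i => (e.symm i).2
  have hmin : ∀ C, IsSubaut δ C → ∃ i, K i ⊆ C := fun C hC => by
    obtain ⟨M, hMC, hM⟩ := exists_minimal_le_of_wellFoundedLT (IsSubaut δ) C hC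
    exact ⟨e ⟨M, hM⟩, by simpa [K] using hMC⟩
  have huniq : ∀ {i j a}, K i ⊆ Rset δ a → K j ⊆ Rset δ a → i = j := fun hi hj =>
    e.symm.injective (Subtype.ext (h.1.minimal_unique (hK _) (hK _) hi hj))
  let P : Fin n → Set A := fun i => {a | K i ⊆ Rset δ a}
  have hKP : ∀ i, K i ⊆ P i := fun i a ha =>
    (hK i).le_of_le (isSubaut_Rset δ a) (Rset_subset_of_mem (hK i).prop.2 ha)
  refine ⟨n, P, K, fun i => ⟨(hK i).prop.1.mono (hKP i), fun a ha x => ?_⟩, fun i j hij =>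
    Set.disjoint_left.2 fun a hi hj => hij (huniq hi hj), ?_,
    fun i => h.mono (Set.subset_univ _), fun i => ⟨(hK i).prop, hKP i, fun C hC hs => ?_⟩,
    fun i j => h.1.autIsoOn_minimal (hK i) (hK j)⟩
  · obtain ⟨j, hj⟩ := hmin _ (isSubaut_Rset δ (δ a x))
    have hij : j = i := huniq (hj.trans (Rset_mono δ ⟨[x], rfl⟩)) ha
    exact hij ▸ hj
  · refine Set.eq_univ_of_forall fun a => ?_
    obtain ⟨j, hj⟩ := hmin _ (isSubaut_Rset δ a)
    exact Set.mem_iUnion.2 ⟨j, hj⟩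
  · obtain ⟨j, hj⟩ := hmin C hs
    obtain ⟨c, hc⟩ := hs.1
    obtain ⟨k, hk⟩ := hmin _ (isSubaut_Rset δ c)
    have hkC : K k ⊆ C := hk.trans (Rset_subset_of_mem hs.2 hc)
    exact (huniq hk (hC hc)) ▸ hkC

open Classical in
/-- A finite direct sum of Boolean-type retractable automata with pairwise isomorphic kernels
is a Boolean-type retractable automaton. -/
lemma BooleanTypeOn.of_direct_sum [Nonempty A] {δ : A → X → A} {n : ℕ} {P K : Fin n → Set A}
    (hP : ∀ i, IsSubaut δ (P i)) (hdisj : ∀ i j, i ≠ j → Disjoint (P i) (P j))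
    (hcov : (⋃ i, P i) = Set.univ) (hbool : ∀ i, BooleanTypeOn δ (P i))
    (hker : ∀ i, IsKernelOf δ (P i) (K i)) (hiso : ∀ i j, AutIsoOn δ (K i) (K j)) :
    BooleanTypeOn δ Set.univ := by
  have hex : ∀ a, ∃ i, a ∈ P i := fun a => by
    simpa using hcov.ge (Set.mem_univ a)
  choose idx hidx using hex
  have idx_eq : ∀ {a i}, a ∈ P i → idx a = i := fun {a i} ha => by
    by_contra hne
    exact Set.disjoint_left.1 (hdisj _ _ hne) (hidx a) ha
  have idx_d : ∀ a x, idx (δ a x) = idx a := fun a x => idx_eq ((hP _).2 a (hidx a) x)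
  let o : Fin n := idx (Classical.arbitrary A)
  have : Nonempty (Fin n) := ⟨o⟩
  choose _ L hL hLker using hbool
  choose f g hfm hgm hgf hfg hfh hgh using
    fun i => AutIsoOn.exists_inverse (hker i).1 (hiso i o)
  have hLK : ∀ i, IsRetractHomOn δ (P i) (K i) (L i (K i)) := fun i =>
    hL i _ (hker i).2.1 (hker i).1
  -- the homomorphism of the whole automaton onto the common kernel
  let κ : A → A := fun a => f (idx a) (L (idx a) (K (idx a)) a)
  have κ_mem : ∀ a, κ a ∈ K o := fun a => hfm _ ((hLK _).2.1 a (hidx a))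
  have κ_d : ∀ a x, κ (δ a x) = δ (κ a) x := fun a x => by
    simp only [κ, idx_d]
    rw [(hLK _).1 a (hidx a), hfh _ _ ((hLK _).2.1 a (hidx a))]
  have κ_g : ∀ j, ∀ b ∈ K o, κ (g j b) = b := fun j b hb => by
    have hgK := hgm j hb
    simp only [κ, idx_eq ((hker j).2.1 hgK), (hLK j).2.2 _ hgK, hfg j b hb]
  have hfirst : ∀ C, IsSubaut δ C →
      ∃ j, (C ∩ P j).Nonempty ∧ ∀ i, (C ∩ P i).Nonempty → j ≤ i := fun C hC => by
    obtain ⟨c, hc⟩ := hC.1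
    obtain ⟨j, -, hj⟩ := exists_minimal_le_of_wellFoundedLT
      (fun i => (C ∩ P i).Nonempty) (idx c) ⟨c, hc, hidx c⟩
    exact ⟨j, hj.prop, fun i hi => (le_total j i).elim id (fun h => hj.le_of_le hi h)⟩
  choose! m hm hm_le using hfirst
  let Λ : Set A → A → A := fun C a =>
    if (C ∩ P (idx a)).Nonempty then L (idx a) (C ∩ P (idx a)) a else g (m C) (κ a)
  have Λ_pos : ∀ {C a}, (C ∩ P (idx a)).Nonempty → Λ C a = L (idx a) (C ∩ P (idx a)) a :=
    fun h => if_pos h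
  have Λ_neg : ∀ {C a}, ¬ (C ∩ P (idx a)).Nonempty → Λ C a = g (m C) (κ a) :=
    fun h => if_neg h
  have hLC : ∀ {C i}, IsSubaut δ C → (C ∩ P i).Nonempty →
      IsRetractHomOn δ (P i) (C ∩ P i) (L i (C ∩ P i)) := fun hC hi =>
    hL _ _ Set.inter_subset_right (hC.inter (hP _) hi)
  have hKC : ∀ {C i}, IsSubaut δ C → (C ∩ P i).Nonempty → K i ⊆ C ∩ P i := fun hC hi =>
    (hker _).2.2 _ Set.inter_subset_right (hC.inter (hP _) hi)
  have g_mem : ∀ {C}, IsSubaut δ C → ∀ a, g (m C) (κ a) ∈ C ∩ P (m C) := fun hC a =>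
    hKC hC (hm _ hC) (hgm _ (κ_mem a))
  have hΛ : ∀ C, C ⊆ Set.univ → IsSubaut δ C → IsRetractHomOn δ Set.univ C (Λ C) := by
    refine fun C _ hC => ⟨fun a _ x => ?_, fun a _ => ?_, fun c hc => ?_⟩
    · by_cases hi : (C ∩ P (idx a)).Nonempty
      · rw [Λ_pos hi, Λ_pos (by rwa [idx_d]), idx_d]
        exact (hLC hC hi).1 a (hidx a) x
      · rw [Λ_neg hi, Λ_neg (by rwa [idx_d]), κ_d]
        exact hgh _ _ (κ_mem a) x
    · by_cases hi : (C ∩ P (idx a)).Nonempty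
      · rw [Λ_pos hi]
        exact ((hLC hC hi).2.1 a (hidx a)).1
      · rw [Λ_neg hi]
        exact (g_mem hC a).1
    · have hi : (C ∩ P (idx c)).Nonempty := ⟨c, hc, hidx c⟩
      rw [Λ_pos hi]
      exact (hLC hC hi).2.2 c ⟨hc, hidx c⟩
  have κ_Λ : ∀ {C}, IsSubaut δ C → ∀ a, κ (Λ C a) = κ a := fun {C} hC a => by
    by_cases hi : (C ∩ P (idx a)).Nonempty
    · have hr := hLC hC hi
      have hmem := hr.2.1 a (hidx a)
      rw [Λ_pos hi]
      simp only [κ, idx_eq hmem.2]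
      rw [hLker _ _ _ (hKC hC hi) Set.inter_subset_right (hker _).1 (hC.inter (hP _) hi)
        _ hmem.2 a (hidx a) (hr.2.2 _ hmem)]
    · rw [Λ_neg hi, κ_g _ _ (κ_mem a)]
  have hmixed : ∀ {C₁ C₂}, C₁ ⊆ C₂ → IsSubaut δ C₁ → IsSubaut δ C₂ → ∀ {a b},
      (C₁ ∩ P (idx a)).Nonempty → ¬ (C₁ ∩ P (idx b)).Nonempty →
      Λ C₂ a = Λ C₂ b → Λ C₁ a = Λ C₁ b := by
    intro C₁ C₂ h12 h1 h2 a b ha hb hab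
    have ha2 : (C₂ ∩ P (idx a)).Nonempty := ha.mono (Set.inter_subset_inter_left _ h12)
    have hr2 := hLC h2 ha2
    have hmem := hr2.2.1 a (hidx a)
    rw [Λ_pos ha2] at hab
    have hb2 : ¬ (C₂ ∩ P (idx b)).Nonempty := fun hb2 => by
      rw [Λ_pos hb2] at hab
      rw [hab] at hmem
      have : idx b = idx a :=
        (idx_eq ((hLC h2 hb2).2.1 b (hidx b)).2).symm.trans (idx_eq hmem.2)
      exact hb (this ▸ ha)
    rw [Λ_neg hb2] at hab
    have hm2 : m C₂ = idx a := (idx_eq (g_mem h2 b).2).symm.trans (idx_eq (hab ▸ hmem.2))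
    have hm1 : m C₁ = idx a := le_antisymm (hm_le _ h1 _ ha)
      (hm2 ▸ hm_le _ h2 _ ((hm _ h1).mono (Set.inter_subset_inter_left _ h12)))
    rw [Λ_pos ha, Λ_neg hb, hm1]
    rw [hm2] at hab
    have hgK : g (idx a) (κ b) ∈ K (idx a) := hgm _ (κ_mem b)
    have hstep := hLker _ _ _ (Set.inter_subset_inter_left _ h12) Set.inter_subset_right
      (h1.inter (hP _) ha) (h2.inter (hP _) ha2) a (hidx a) _ ((hker _).2.1 hgK)
      (hab.trans (hr2.2.2 _ (hKC h2 ha2 hgK)).symm)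
    rw [hstep, (hLC h1 ha).2.2 _ (hKC h1 ha hgK)]
  refine ⟨fun C hC hs => ⟨Λ C, hΛ C hC hs⟩, Λ, hΛ, fun C₁ C₂ h12 _ h1 h2 a _ b _ hab => ?_⟩
  by_cases ha : (C₁ ∩ P (idx a)).Nonempty <;> by_cases hb : (C₁ ∩ P (idx b)).Nonempty
  · have ha2 := ha.mono (Set.inter_subset_inter_left _ h12)
    have hb2 := hb.mono (Set.inter_subset_inter_left _ h12)
    rw [Λ_pos ha2, Λ_pos hb2] at hab
    have hidx_eq : idx b = idx a := (idx_eq ((hLC h2 hb2).2.1 b (hidx b)).2).symm.trans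
      (idx_eq (hab ▸ ((hLC h2 ha2).2.1 a (hidx a)).2))
    rw [Λ_pos ha, Λ_pos hb, hidx_eq]
    rw [hidx_eq] at hab
    exact hLker _ _ _ (Set.inter_subset_inter_left _ h12) Set.inter_subset_right
      (h1.inter (hP _) ha) (h2.inter (hP _) ha2) a (hidx a) b (hidx_eq ▸ hidx b) hab
  · exact hmixed h12 h1 h2 ha hb hab
  · exact (hmixed h12 h1 h2 hb ha hab.symm).symm
  · rw [Λ_neg ha, Λ_neg hb, ← κ_Λ h2 a, hab, κ_Λ h2 b]

/-- A state-finite automaton is a Boolean-type retractable automaton iff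
it is a direct sum of finitely many state-finite Boolean-type retractable automata, each
containing a kernel, whose kernels are pairwise isomorphic. -/
theorem booleanType_iff_direct_sum [Finite A] [Nonempty A] [Nonempty X] (δ : A → X → A) :
    BooleanTypeOn δ Set.univ ↔
      ∃ (n : ℕ) (P K : Fin n → Set A),
        (∀ i, IsSubaut δ (P i)) ∧
        (∀ i j, i ≠ j → Disjoint (P i) (P j)) ∧
        (⋃ i, P i) = Set.univ ∧
        (∀ i, BooleanTypeOn δ (P i)) ∧
        (∀ i, IsKernelOf δ (P i) (K i)) ∧
        (∀ i j, AutIsoOn δ (K i) (K j)) := by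
  refine ⟨fun h => h.exists_direct_sum, ?_⟩
  rintro ⟨n, P, K, hP, hdisj, hcov, hbool, hker, hiso⟩
  exact .of_direct_sum hP hdisj hcov hbool hker hiso
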